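/- Let f be an integrable function on ℝ² such that for every angle θ, the marginal (line projection) h_θ(z) = ∫ f(R_θ⁻¹(z, w)) dw vanishes for almost every z, where R_θ is rotation by θ. Then f = 0 almost everywhere. -/

import Mathlib

open MeasureTheory

lemma radon_rot_mp (θ : ℝ) :
    MeasurePreserving (fun p : ℝ × ℝ => (p.1 * Real.cos θ - p.2 * Real.sin θ,
      p.1 * Real.sin θ + p.2 * Real.cos θ)) ∧
    MeasurableEmbedding (fun p : ℝ × ℝ => (p.1 * Real.cos θ - p.2 * Real.sin θ,
      p.1 * Real.sin θ + p.2 * Real.cos θ)) := by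
  have hc : Continuous (fun p : ℝ × ℝ => (p.1 * Real.cos θ - p.2 * Real.sin θ,
      p.1 * Real.sin θ + p.2 * Real.cos θ)) := by fun_prop
  have hs := Real.sin_sq_add_cos_sq θ
  refine ⟨⟨hc.measurable, ?_⟩, hc.measurableEmbedding ?_⟩
  · let A : ℝ × ℝ →ₗ[ℝ] ℝ × ℝ := Matrix.toLin (Module.Basis.finTwoProd ℝ) (Module.Basis.finTwoProd ℝ)
      !![Real.cos θ, -Real.sin θ; Real.sin θ, Real.cos θ]
    have hdet : LinearMap.det A = 1 := by
      simp only [A, LinearMap.det_toLin, Matrix.det_fin_two_of]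
      linarith
    have hA : (fun p : ℝ × ℝ => (p.1 * Real.cos θ - p.2 * Real.sin θ,
      p.1 * Real.sin θ + p.2 * Real.cos θ)) = A := by
      funext p
      simp only [A, Matrix.toLin_finTwoProd_apply]
      ext <;> simp <;> ring
    rw [hA, Measure.map_linearMap_addHaar_eq_smul_addHaar _ (by rw [hdet]; exact one_ne_zero), hdet]
    simp
  · rintro ⟨a, b⟩ ⟨c, d⟩ h
    simp only [Prod.mk.injEq] at h ⊢
    obtain ⟨h1, h2⟩ := h
    constructor
    · linear_combination Real.cos θ * h1 + Real.sin θ * h2 - (a - c) * hs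
    · linear_combination -Real.sin θ * h1 + Real.cos θ * h2 - (b - d) * hs

lemma radon_fourier_zero
    (f : ℝ × ℝ → ℝ) (hf : Integrable f)
    (hproj : ∀ θ : ℝ, ∀ᵐ z : ℝ,
        (∫ w : ℝ, f (z * Real.cos θ - w * Real.sin θ,
                      z * Real.sin θ + w * Real.cos θ)) = 0) (a b : ℝ) :
    ∫ p : ℝ × ℝ, (f p : ℂ) * Complex.exp (((a * p.1 + b * p.2 : ℝ) : ℂ) * Complex.I) = 0 := by
  obtain ⟨r, θ, ha, hb⟩ : ∃ r θ : ℝ, a = r * Real.cos θ ∧ b = r * Real.sin θ := by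
    refine ⟨‖(⟨a, b⟩ : ℂ)‖, Complex.arg ⟨a, b⟩, ?_, ?_⟩
    · rw [Complex.norm_mul_cos_arg]
    · rw [Complex.norm_mul_sin_arg]
  obtain ⟨h1, h2⟩ := radon_rot_mp θ
  have hs := Real.sin_sq_add_cos_sq θ
  have hinteg : Integrable (fun p : ℝ × ℝ =>
      (f p : ℂ) * Complex.exp (((a * p.1 + b * p.2 : ℝ) : ℂ) * Complex.I)) := by
    refine hf.ofReal.mul_bdd (c := 1) ?_ ?_
    · exact Continuous.aestronglyMeasurable (by fun_prop)
    · exact Filter.Eventually.of_forall fun p => (Complex.norm_exp_ofReal_mul_I _).le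
  rw [← h1.integral_comp h2]
  have hinteg' := (h1.integrable_comp_emb h2).2 hinteg
  rw [Measure.volume_eq_prod] at hinteg' ⊢
  refine (integral_prod _ hinteg').trans ?_
  apply integral_eq_zero_of_ae
  filter_upwards [hproj θ] with z hz
  have : ∀ w : ℝ, a * (z * Real.cos θ - w * Real.sin θ) + b * (z * Real.sin θ + w * Real.cos θ)
      = r * z := by
    intro w
    rw [ha, hb]
    linear_combination r * z * hs
  simp only [Function.comp_apply, this]
  rw [integral_mul_const, integral_complex_ofReal, hz]
  simp

/-- Radon-transform uniqueness in the plane: if an integrable `f : ℝ² → ℝ` has all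
of its line-projection marginals `h_θ(z) = ∫ f(R_θ⁻¹(z,w)) dw` vanishing for a.e.
`z`, for every rotation angle `θ`, then `f = 0` almost everywhere. -/
theorem radon_transform_injective
    (f : ℝ × ℝ → ℝ) (hf : Integrable f)
    (hproj : ∀ θ : ℝ, ∀ᵐ z : ℝ,
        (∫ w : ℝ, f (z * Real.cos θ - w * Real.sin θ,
                      z * Real.sin θ + w * Real.cos θ)) = 0) :
    f =ᵐ[volume] 0 := by
  have hm := hf.aemeasurable
  have hp : AEMeasurable (fun p => ENNReal.ofReal (f p)) := hm.ennreal_ofReal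
  have hn : AEMeasurable (fun p => ENNReal.ofReal (-f p)) := hm.neg.ennreal_ofReal
  have hfp : ∫⁻ p, ENNReal.ofReal (f p) ≠ ⊤ := hf.lintegral_lt_top.ne
  have hfn : ∫⁻ p, ENNReal.ofReal (-f p) ≠ ⊤ := hf.neg.lintegral_lt_top.ne
  have : IsFiniteMeasure (volume.withDensity (fun p => ENNReal.ofReal (f p))) :=
    isFiniteMeasure_withDensity hfp
  have : IsFiniteMeasure (volume.withDensity (fun p => ENNReal.ofReal (-f p))) :=
    isFiniteMeasure_withDensity hfn
  have key : volume.withDensity (fun p => ENNReal.ofReal (f p))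
      = volume.withDensity (fun p => ENNReal.ofReal (-f p)) := by
    apply Measure.ext_of_charFunDual
    funext L
    rw [charFunDual_apply, charFunDual_apply,
      integral_withDensity_eq_integral_toReal_smul₀ hp (by simp),
      integral_withDensity_eq_integral_toReal_smul₀ hn (by simp), ← sub_eq_zero, ← integral_sub]
    · rw [← radon_fourier_zero f hf hproj (L (1, 0)) (L (0, 1))]
      congr 1
      funext p
      have hL : L p = L (1, 0) * p.1 + L (0, 1) * p.2 := by
        have : p = p.1 • ((1, 0) : ℝ × ℝ) + p.2 • ((0, 1) : ℝ × ℝ) := by ext <;> simp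
        conv_lhs => rw [this]
        rw [map_add, map_smul, map_smul, smul_eq_mul, smul_eq_mul]
        ring
      rw [← hL, ← sub_smul, Complex.real_smul, ENNReal.toReal_ofReal', ENNReal.toReal_ofReal',
        max_zero_sub_max_neg_zero_eq_self]
    · simp only [Complex.real_smul]
      refine (integrable_toReal_of_lintegral_ne_top hp hfp).ofReal.mul_bdd (c := 1) ?_ ?_
      · exact Continuous.aestronglyMeasurable (by fun_prop)
      · exact Filter.Eventually.of_forall fun p => (Complex.norm_exp_ofReal_mul_I _).le
    · simp only [Complex.real_smul]
      refine (integrable_toReal_of_lintegral_ne_top hn hfn).ofReal.mul_bdd (c := 1) ?_ ?_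
      · exact Continuous.aestronglyMeasurable (by fun_prop)
      · exact Filter.Eventually.of_forall fun p => (Complex.norm_exp_ofReal_mul_I _).le
  have h := (withDensity_eq_iff hp hn hfp).1 key
  filter_upwards [h] with p hpp
  have h3 := congrArg ENNReal.toReal hpp
  rw [ENNReal.toReal_ofReal', ENNReal.toReal_ofReal'] at h3
  simp only [Pi.zero_apply]
  rcases le_total 0 (f p) with h0 | h0
  · rw [max_eq_left h0, max_eq_right (by linarith)] at h3; exact h3
  · rw [max_eq_right h0, max_eq_left (by linarith)] at h3; linarith
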